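/- arXiv:2306.16673 — 2 statements merged into one kernel-verified Lean document; each statement's English description precedes it below -/
import Mathlib

section
/- Let A = (a_1, …, a_r) be a tuple of positive integers with r ≥ 3, and let L_A be the abelian group generated by r letters x_1, …, x_r subject to the relations a_i x_i = a_j x_j for all i, j, i.e., the quotient of the free abelian group ⊕_{i=1}^r Z x_i by the subgroup generated by the elements a_i x_i − a_j x_j. Let c denote the common image of the elements a_i x_i in L_A (the canonical element). Then the quotient group L_A / ⟨c⟩ is isomorphic to the direct sum ⊕_{i=1}^r Z/a_iZ. -/
open DirectSum

/-- The subgroup of relations `a_i x_i − a_j x_j` in the free abelian group on `r` letters. -/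
noncomputable def orbRels (r : ℕ) (a : Fin r → ℕ) : AddSubgroup (Fin r →₀ ℤ) :=
  AddSubgroup.closure
    {z | ∃ i j : Fin r, z = (a i : ℤ) • Finsupp.single i 1 - (a j : ℤ) • Finsupp.single j 1}

/-- The group `L_A`: the free abelian group on `x_1, …, x_r` modulo `a_i x_i = a_j x_j`. -/
abbrev LGroup (r : ℕ) (a : Fin r → ℕ) : Type := (Fin r →₀ ℤ) ⧸ orbRels r a

/-- The image of the generator `x_i` in `L_A`. -/
noncomputable def LGen (r : ℕ) (a : Fin r → ℕ) (i : Fin r) : LGroup r a :=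
  QuotientAddGroup.mk (Finsupp.single i 1)

/-- The homomorphism `⊕ ℤ x_i → ⊕ ℤ/a_iℤ` sending `x_i` to the `i`-th unit class. -/
noncomputable def freeToSum (r : ℕ) (a : Fin r → ℕ) :
    (Fin r →₀ ℤ) →+ ⨁ i : Fin r, ZMod (a i) :=
  Finsupp.liftAddHom fun i =>
    (DirectSum.of (fun i => ZMod (a i)) i).comp (Int.castAddHom (ZMod (a i)))

theorem freeToSum_single (r : ℕ) (a : Fin r → ℕ) (i : Fin r) (n : ℤ) :
    freeToSum r a (Finsupp.single i n) = DirectSum.of (fun i => ZMod (a i)) i (n : ZMod (a i)) := by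
  simp [freeToSum]

theorem freeToSum_smul_single (r : ℕ) (a : Fin r → ℕ) (i : Fin r) :
    freeToSum r a ((a i : ℤ) • Finsupp.single i 1) = 0 := by
  rw [Finsupp.smul_single, freeToSum_single]
  simp

theorem orbRels_le_ker_freeToSum (r : ℕ) (a : Fin r → ℕ) :
    orbRels r a ≤ (freeToSum r a).ker := by
  rw [orbRels, AddSubgroup.closure_le]
  rintro _ ⟨i, j, rfl⟩
  rw [SetLike.mem_coe, AddMonoidHom.mem_ker, map_sub, freeToSum_smul_single,
    freeToSum_smul_single, sub_zero]

/-- The homomorphism `L_A → ⊕ ℤ/a_iℤ` sending `x_i` to the `i`-th unit class. -/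
noncomputable def LGroupToSum (r : ℕ) (a : Fin r → ℕ) :
    LGroup r a →+ ⨁ i : Fin r, ZMod (a i) :=
  QuotientAddGroup.lift (orbRels r a) (freeToSum r a) (orbRels_le_ker_freeToSum r a)

theorem LGroupToSum_LGen (r : ℕ) (a : Fin r → ℕ) (i : Fin r) :
    LGroupToSum r a (LGen r a i) = DirectSum.of (fun i => ZMod (a i)) i 1 := by
  have h := freeToSum_single r a i 1
  rw [Int.cast_one] at h
  exact h

theorem LGroupToSum_smul_LGen (r : ℕ) (a : Fin r → ℕ) (i : Fin r) :
    LGroupToSum r a (a i • LGen r a i) = 0 := by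
  rw [map_nsmul, LGroupToSum_LGen, ← map_nsmul]
  simp

/-- Homomorphisms out of `L_A` agree if they agree on the generators. -/
theorem LGroup_hom_ext {r : ℕ} {a : Fin r → ℕ} {M : Type*} [AddCommGroup M]
    {f g : LGroup r a →+ M} (h : ∀ i, f (LGen r a i) = g (LGen r a i)) : f = g := by
  apply QuotientAddGroup.addMonoidHom_ext
  ext i
  exact h i

/-- The homomorphism `⊕ ℤ/a_iℤ → M` determined by elements `y_i` with `a_i y_i = 0`. -/
noncomputable def sumLift {r : ℕ} {a : Fin r → ℕ} {M : Type*} [AddCommGroup M]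
    (y : Fin r → M) (hy : ∀ i, a i • y i = 0) : (⨁ i : Fin r, ZMod (a i)) →+ M :=
  DirectSum.toAddMonoid fun i =>
    ZMod.lift (a i) ⟨zmultiplesHom M (y i), by simpa using hy i⟩

theorem sumLift_of_one {r : ℕ} {a : Fin r → ℕ} {M : Type*} [AddCommGroup M]
    (y : Fin r → M) (hy : ∀ i, a i • y i = 0) (i : Fin r) :
    sumLift y hy (DirectSum.of (fun i => ZMod (a i)) i 1) = y i := by
  rw [sumLift, DirectSum.toAddMonoid_of, ← Int.cast_one, ZMod.lift_coe]
  simp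

/-- Homomorphisms out of `⊕ ℤ/a_iℤ` agree if they agree on the unit classes. -/
theorem sum_hom_ext {r : ℕ} {a : Fin r → ℕ} {M : Type*} [AddCommGroup M]
    {f g : (⨁ i : Fin r, ZMod (a i)) →+ M}
    (h : ∀ i, f (DirectSum.of (fun i => ZMod (a i)) i 1) =
      g (DirectSum.of (fun i => ZMod (a i)) i 1)) : f = g := by
  refine DirectSum.addHom_ext fun i y => ?_
  obtain ⟨n, rfl⟩ := ZMod.intCast_surjective y
  rw [← zsmul_one, map_zsmul, map_zsmul, map_zsmul, h]

/-- `L_A / ⟨c⟩ ≅ ⊕_{i=1}^r ℤ/a_iℤ`, where `c = a_i x_i` is the canonical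
element of `L_A`. -/
theorem quotient_by_canonical_element_iso (r : ℕ) (hr : 3 ≤ r)
    (a : Fin r → ℕ) (ha : ∀ i, 0 < a i)
    (c : LGroup r a) (hc : ∀ i, c = a i • LGen r a i) :
    Nonempty ((LGroup r a ⧸ AddSubgroup.zmultiples c) ≃+ ⨁ i : Fin r, ZMod (a i)) := by
  have hr0 : 0 < r := by omega
  have hker : AddSubgroup.zmultiples c ≤ (LGroupToSum r a).ker := by
    rw [AddSubgroup.zmultiples_le, AddMonoidHom.mem_ker, hc ⟨0, hr0⟩, LGroupToSum_smul_LGen]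
  let π := QuotientAddGroup.mk' (AddSubgroup.zmultiples c)
  have hy : ∀ i, a i • π (LGen r a i) = 0 := fun i => by
    rw [← map_nsmul, ← hc i]
    exact (QuotientAddGroup.eq_zero_iff c).2 (AddSubgroup.mem_zmultiples c)
  let F := QuotientAddGroup.lift (AddSubgroup.zmultiples c) (LGroupToSum r a) hker
  let G := sumLift (fun i => π (LGen r a i)) hy
  have hF : ∀ i, F (π (LGen r a i)) = DirectSum.of (fun i => ZMod (a i)) i 1 :=
    LGroupToSum_LGen r a
  have hG : ∀ i, G (DirectSum.of (fun i => ZMod (a i)) i 1) = π (LGen r a i) :=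
    sumLift_of_one (fun i => π (LGen r a i)) hy
  refine ⟨AddMonoidHom.toAddEquiv F G ?_ ?_⟩
  · apply QuotientAddGroup.addMonoidHom_ext
    refine LGroup_hom_ext (M := LGroup r a ⧸ AddSubgroup.zmultiples c) fun i => ?_
    change G (F (π (LGen r a i))) = π (LGen r a i)
    rw [hF, hG]
  · refine sum_hom_ext fun i => ?_
    rw [AddMonoidHom.comp_apply, hG, hF, AddMonoidHom.id_apply]
end

section
/- Let A = (a_1, …, a_r) be a tuple of positive integers with r ≥ 3, and let L_A be the quotient of the free abelian group on generators x_1, …, x_r by the subgroup generated by a_i x_i − a_j x_j for all i, j, with canonical element c := a_1 x_1 = … = a_r x_r. Then every element x of L_A can be written uniquely in the normal form x = l·c + Σ_{i=1}^r l_i·x_i with l ∈ Z and integers l_i satisfying 0 ≤ l_i < a_i for each i; that is, the integers l, l_1, …, l_r with these constraints exist and are uniquely determined by x. -/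
theorem exists_mul_of_mem_orbRels {r : ℕ} {a : Fin r → ℕ} {z : Fin r →₀ ℤ}
    (hz : z ∈ orbRels r a) :
    ∃ m : Fin r → ℤ, (∀ i, z i = a i * m i) ∧ ∑ i, m i = 0 := by
  induction hz using AddSubgroup.closure_induction with
  | mem z hz =>
    obtain ⟨i, j, rfl⟩ := hz
    refine ⟨Pi.single i 1 - Pi.single j 1, fun k => ?_, by simp⟩
    simp only [Finsupp.sub_apply, Finsupp.smul_apply, Finsupp.single_apply, Pi.sub_apply,
      Pi.single_apply, smul_eq_mul, mul_sub]
    congr 1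
    · by_cases h : i = k
      · simp [h]
      · simp [h, Ne.symm h]
    · by_cases h : j = k
      · simp [h]
      · simp [h, Ne.symm h]
  | zero => exact ⟨0, by simp, by simp⟩
  | add y z _ _ hy hz =>
    obtain ⟨m, hm, hm'⟩ := hy
    obtain ⟨n, hn, hn'⟩ := hz
    exact ⟨m + n, fun i => by simp [hm, hn, mul_add], by simp [Finset.sum_add_distrib, hm', hn']⟩
  | neg y _ hy =>
    obtain ⟨m, hm, hm'⟩ := hy
    exact ⟨-m, fun i => by simp [hm], by simp [hm']⟩

theorem mk_eq_sum_zsmul_LGen {r : ℕ} (a : Fin r → ℕ) (z : Fin r →₀ ℤ) :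
    (QuotientAddGroup.mk z : LGroup r a) = ∑ i, z i • LGen r a i := by
  conv_lhs => rw [← Finsupp.univ_sum_single z]
  rw [← QuotientAddGroup.mk'_apply, map_sum]
  refine Finset.sum_congr rfl fun i _ => ?_
  rw [LGen, ← QuotientAddGroup.mk_zsmul, QuotientAddGroup.mk'_apply]
  simp

theorem exists_mul_of_sum_zsmul_LGen_eq_zero {r : ℕ} {a : Fin r → ℕ} {k : Fin r → ℤ}
    (hk : ∑ i, k i • LGen r a i = 0) :
    ∃ m : Fin r → ℤ, (∀ i, k i = a i * m i) ∧ ∑ i, m i = 0 := by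
  have h : (QuotientAddGroup.mk (Finsupp.equivFunOnFinite.symm k) : LGroup r a) = 0 := by
    rw [mk_eq_sum_zsmul_LGen]
    simpa using hk
  simpa using exists_mul_of_mem_orbRels ((QuotientAddGroup.eq_zero_iff _).mp h)

theorem existsUnique_zsmul_add_sum_nsmul {ι G : Type*} [Fintype ι] [Nonempty ι]
    [AddCommGroup G] {a : ι → ℕ} (ha : ∀ i, 0 < a i) {g : ι → G} {c : G}
    (hc : ∀ i, c = a i • g i)
    (hrel : ∀ k : ι → ℤ, ∑ i, k i • g i = 0 →
      ∃ m : ι → ℤ, (∀ i, k i = a i * m i) ∧ ∑ i, m i = 0) (z : ι → ℤ) :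
    ∃! p : ℤ × (ι → ℕ), (∀ i, p.2 i < a i) ∧
      ∑ i, z i • g i = p.1 • c + ∑ i, p.2 i • g i := by
  classical
  refine existsUnique_of_exists_of_unique ?_ ?_
  · refine ⟨(∑ i, z i / a i, fun i => (z i % a i).toNat), fun i => ?_, ?_⟩
    · have h : (0 : ℤ) < a i := by exact_mod_cast ha i
      have := Int.emod_lt_of_pos (z i) h
      have := Int.emod_nonneg (z i) h.ne'
      dsimp only
      omega
    · dsimp only
      rw [Finset.sum_smul, ← Finset.sum_add_distrib]
      refine Finset.sum_congr rfl fun i _ => ?_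
      have h : (0 : ℤ) < a i := by exact_mod_cast ha i
      rw [hc i, ← natCast_zsmul (g i) (a i), ← natCast_zsmul (g i) (Int.toNat _),
        smul_smul, ← add_smul, Int.toNat_of_nonneg (Int.emod_nonneg (z i) h.ne'),
        Int.ediv_mul_add_emod]
  · rintro ⟨l, n⟩ ⟨l', n'⟩ ⟨hn, hx⟩ ⟨hn', hx'⟩
    dsimp only at hn hx hn' hx'
    obtain ⟨o⟩ := ‹Nonempty ι›
    have hsum : ∑ i, ((if i = o then (l - l') * a i else 0) + (n i - n' i : ℤ)) • g i
        = 0 := by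
      simp only [add_smul, sub_smul, ite_smul, zero_smul, Finset.sum_add_distrib,
        Finset.sum_sub_distrib, Finset.sum_ite_eq', Finset.mem_univ, if_true, mul_smul,
        natCast_zsmul, ← hc]
      rw [hx, ← sub_eq_zero] at hx'
      rw [← hx']
      abel
    obtain ⟨m, hm, hm0⟩ := hrel _ hsum
    have hnn : n = n' := by
      funext i
      have hdvd : (a i : ℤ) ∣ n i - n' i := by
        have h := Dvd.intro (m i) (hm i).symm
        refine (dvd_add_right ?_).mp h
        split_ifs
        · exact dvd_mul_left _ _
        · exact dvd_zero _
      have h := Int.eq_zero_of_abs_lt_dvd hdvd (by have := hn i; have := hn' i; rw [abs_lt]; omega)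
      omega
    subst hnn
    have hm' : ∀ i, m i = if i = o then l - l' else 0 := fun i => by
      have h : (a i : ℤ) ≠ 0 := by exact_mod_cast (ha i).ne'
      apply mul_left_cancel₀ h
      rw [← hm i]
      split_ifs <;> ring
    have hl : l = l' := by
      simp only [hm', Finset.sum_ite_eq', Finset.mem_univ, if_true] at hm0
      omega
    rw [hl]

/-- every element of `L_A` has a unique normal form
`x = l·c + ∑ l_i·x_i` with `l ∈ ℤ` and `0 ≤ l_i < a_i`. -/
theorem normal_form_exists_unique (r : ℕ) (hr : 3 ≤ r)
    (a : Fin r → ℕ) (ha : ∀ i, 0 < a i)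
    (c : LGroup r a) (hc : ∀ i, c = a i • LGen r a i) (x : LGroup r a) :
    ∃! p : ℤ × (Fin r → ℕ), (∀ i, p.2 i < a i) ∧
      x = p.1 • c + ∑ i, (p.2 i) • LGen r a i := by
  have : Nonempty (Fin r) := ⟨⟨0, by omega⟩⟩
  obtain ⟨z, rfl⟩ := QuotientAddGroup.mk_surjective x
  rw [mk_eq_sum_zsmul_LGen]
  exact existsUnique_zsmul_add_sum_nsmul ha hc
    (fun _ => exists_mul_of_sum_zsmul_LGen_eq_zero) z
end
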